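/- arXiv:2305.16539 — 3 statements merged into one kernel-verified Lean document; each statement's English description precedes it below -/
import Mathlib

section
/- Let N ∈ ℕ and let μ = (μ_1,μ_2) and ν = (ν_1,ν_2) be pairs of nondegenerate Gaussian Borel measures on ℝ^N, i.e., each μ_i and ν_i is the law of A_0 Z + m_0 for some invertible N×N real matrix A_0, some m_0 ∈ ℝ^N, and Z a standard Gaussian random vector on ℝ^N (equivalently, a Gaussian measure with everywhere positive density with respect to Lebesgue measure). Then K(μ,ν) and K(ν,μ) are both nonempty if and only if there exist an invertible N×N real matrix A and a vector b ∈ ℝ^N such that the affine map T(x) = Ax + b satisfies μ_i ∘ T⁻¹ = ν_i for i = 1,2 (i.e., T pushes μ_i forward to ν_i for both i). -/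
open MeasureTheory ProbabilityTheory ENNReal

noncomputable section

/-- `κ` is a simultaneous transport kernel from the tuple `μ` to the tuple `ν`:
it is a Markov kernel and `∫ κ(x,·) dμ_j ≥ ν_j` for every `j`. -/
def IsSimulKernel {X Y : Type*} [MeasurableSpace X] [MeasurableSpace Y] {d : ℕ}
    (κ : Kernel X Y) (μ : Fin d → Measure X) (ν : Fin d → Measure Y) : Prop :=
  IsMarkovKernel κ ∧ ∀ j, ν j ≤ (μ j).bind (fun x => κ x)

/-- `T` is a simultaneous (Monge) transport map from `μ` to `ν`. -/
def IsSimulMap {X Y : Type*} [MeasurableSpace X] [MeasurableSpace Y] {d : ℕ}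
    (T : X → Y) (μ : Fin d → Measure X) (ν : Fin d → Measure Y) : Prop :=
  Measurable T ∧ ∀ j, ν j ≤ (μ j).map T

/-- The heterogeneity order `μ ⪰_h ν`: there are dominating probability measures whose
density vectors are comparable in the multivariate increasing convex order. -/
def HeteroOrder {X Y : Type*} [MeasurableSpace X] [MeasurableSpace Y] {d : ℕ}
    (μ : Fin d → Measure X) (ν : Fin d → Measure Y) : Prop :=
  ∃ (lam : Measure X) (rho : Measure Y) (g : X → Fin d → ℝ) (h : Y → Fin d → ℝ),
    IsProbabilityMeasure lam ∧ IsProbabilityMeasure rho ∧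
    Measurable g ∧ Measurable h ∧
    (∀ j, μ j = lam.withDensity (fun x => ENNReal.ofReal (g x j))) ∧
    (∀ j, ν j = rho.withDensity (fun y => ENNReal.ofReal (h y j))) ∧
    ∀ f : (Fin d → ℝ) → ℝ, ConvexOn ℝ Set.univ f → Monotone f →
      Integrable (fun x => f (g x)) lam → Integrable (fun y => f (h y)) rho →
      ∫ y, f (h y) ∂rho ≤ ∫ x, f (g x) ∂lam

/-- The tuple `μ` is jointly atomless: some dominating probability measure carries an
atomlessly distributed random variable independent of the density vector of `μ`. -/
def JointlyAtomless {X : Type*} [MeasurableSpace X] {d : ℕ}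
    (μ : Fin d → Measure X) : Prop :=
  ∃ (lam : Measure X) (g : X → Fin d → ℝ) (ξ : X → ℝ),
    IsProbabilityMeasure lam ∧ Measurable g ∧ Measurable ξ ∧
    (∀ j, μ j = lam.withDensity (fun x => ENNReal.ofReal (g x j))) ∧
    (∀ r : ℝ, lam (ξ ⁻¹' {r}) = 0) ∧
    IndepFun ξ g lam

/-- Normalized average of a tuple of measures. -/
def avg {X : Type*} [MeasurableSpace X] {d : ℕ} (μ : Fin d → Measure X) : Measure X :=
  ((∑ j, μ j) Set.univ)⁻¹ • ∑ j, μ j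

/-- Transport cost of a kernel with respect to the reference measure `η`. -/
def kernelCost {X Y : Type*} [MeasurableSpace X] [MeasurableSpace Y]
    (c : X → Y → ℝ≥0∞) (η : Measure X) (κ : Kernel X Y) : ℝ≥0∞ :=
  ∫⁻ x, ∫⁻ y, c x y ∂(κ x) ∂η

/-- The set `Π_η(μ,ν)` of transport plans `η ⊗ κ` with `κ ∈ K(μ,ν)`. -/
def PiSet {X Y : Type*} [MeasurableSpace X] [MeasurableSpace Y] {d : ℕ}
    (η : Measure X) (μ : Fin d → Measure X) (ν : Fin d → Measure Y) :
    Set (Measure (X × Y)) :=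
  {π | ∃ κ : Kernel X Y, IsSimulKernel κ μ ν ∧ π = η.compProd κ}

/-- Kernel condition for a single pair of (possibly non-probability) measures. -/
def IsKernelLe {X Y : Type*} [MeasurableSpace X] [MeasurableSpace Y]
    (κ : Kernel X Y) (α : Measure X) (β : Measure Y) : Prop :=
  IsMarkovKernel κ ∧ β ≤ α.bind (fun x => κ x)

/-- Classical (d = 1) optimal transport cost between two measures. -/
def OTCost {X Y : Type*} [MeasurableSpace X] [MeasurableSpace Y]
    (c : X → Y → ℝ≥0∞) (α : Measure X) (β : Measure Y) : ℝ≥0∞ :=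
  ⨅ π ∈ {π : Measure (X × Y) | π.map Prod.fst = α ∧ π.map Prod.snd = β},
    ∫⁻ p, c p.1 p.2 ∂π

/-- `g` is a (Borel) version of the density vector of the tuple `μ` w.r.t. `m`. -/
def IsDensityVec {X : Type*} [MeasurableSpace X] {d : ℕ}
    (μ : Fin d → Measure X) (m : Measure X) (g : X → Fin d → ℝ) : Prop :=
  Measurable g ∧ ∀ j, μ j = m.withDensity (fun x => ENNReal.ofReal (g x j))

/-- `K` is a disintegration of `m` along the map `g` with mixing measure `P = m ∘ g⁻¹`. -/
def IsDisintegration {X : Type*} [MeasurableSpace X] {d : ℕ}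
    (P : Measure (Fin d → ℝ)) (g : X → Fin d → ℝ) (m : Measure X)
    (K : Kernel (Fin d → ℝ) X) : Prop :=
  IsMarkovKernel K ∧ (∀ᵐ z ∂P, K z (g ⁻¹' {z}) = 1) ∧
    m = P.bind (fun z => K z)

/-- Topological support of a measure. -/
def measSupport {X : Type*} [TopologicalSpace X] [MeasurableSpace X]
    (m : Measure X) : Set X :=
  {x | ∀ U : Set X, IsOpen U → x ∈ U → m U ≠ 0}

/-- The standard Gaussian measure on `ℝ^N`. -/
def stdGaussianPi (N : ℕ) : Measure (Fin N → ℝ) :=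
  Measure.pi (fun _ => gaussianReal 0 1)

/-- `γ` is a nondegenerate Gaussian measure on `ℝ^N`: the law of `A₀ Z + m₀` with `A₀`
invertible and `Z` standard Gaussian. -/
def IsNondegGaussian {N : ℕ} (γ : Measure (Fin N → ℝ)) : Prop :=
  ∃ (A : Matrix (Fin N) (Fin N) ℝ) (m : Fin N → ℝ), A.det ≠ 0 ∧
    γ = (stdGaussianPi N).map (fun z => A.mulVec z + m)

open Polynomial in
lemma pole_lemma (S : Finset ℝ) (k : ℕ) (hk : k ≠ 0) (r : ℝ → ℝ[X]) (R : ℝ[X])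
    (hS : ∀ a ∈ S, -1 < a)
    (h : ∀ t ∈ Set.Ioo (0:ℝ) 1, ∑ a ∈ S, (r a).eval t / (1 + t * a) ^ k + R.eval t = 0)
    (a₀ : ℝ) (ha : a₀ ∈ S) (h0 : a₀ ≠ 0) : (r a₀).eval (-1 / a₀) = 0 := by
  classical
  set Q : ℝ[X] := ∑ a ∈ S, r a * ∏ b ∈ S.erase a, (1 + X * C b) ^ k
    + R * ∏ b ∈ S, (1 + X * C b) ^ k with hQ
  have hne : ∀ t ∈ Set.Ioo (0:ℝ) 1, ∀ a ∈ S, (1 + t * a) ≠ 0 := by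
    intro t ht a haS
    have := hS a haS
    have h1 := ht.1
    have h2 := ht.2
    nlinarith
  have hz : Q = 0 := by
    apply Polynomial.eq_zero_of_infinite_isRoot
    apply (Set.Ioo_infinite (show (0:ℝ) < 1 by norm_num)).mono
    intro t ht
    have h1 := h t ht
    have : Q.eval t = (∑ a ∈ S, (r a).eval t / (1 + t * a) ^ k + R.eval t)
        * ∏ b ∈ S, (1 + t * b) ^ k := by
      simp only [hQ, eval_add, eval_finsetSum, eval_mul, eval_prod, eval_pow, eval_one, eval_X,
        eval_C, add_mul, Finset.sum_mul]
      congr 1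
      apply Finset.sum_congr rfl
      intro a haS
      rw [← Finset.mul_prod_erase S _ haS]
      have := hne t ht a haS
      field_simp
    simp only [Set.mem_ofPred_eq, IsRoot.def]
    rw [this, h1, zero_mul]
  have he : Q.eval (-1 / a₀) = (r a₀).eval (-1 / a₀)
      * ∏ b ∈ S.erase a₀, (1 + (-1 / a₀) * b) ^ k := by
    simp only [hQ, eval_add, eval_finsetSum, eval_mul, eval_prod, eval_pow, eval_one, eval_X,
        eval_C]
    have hz0 : (1 + (-1 / a₀) * a₀) ^ k = 0 := by
      rw [show 1 + (-1 / a₀) * a₀ = 0 by field_simp; ring, zero_pow hk]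
    rw [Finset.prod_eq_zero ha hz0, mul_zero, add_zero, Finset.sum_eq_single a₀]
    · intro b hb hba
      rw [Finset.prod_eq_zero (Finset.mem_erase.2 ⟨hba.symm, ha⟩) hz0, mul_zero]
    · intro h; exact absurd ha h
  rw [hz, eval_zero] at he
  rcases mul_eq_zero.1 he.symm with h1 | h1
  · exact h1
  · exfalso
    rw [Finset.prod_eq_zero_iff] at h1
    obtain ⟨b, hb, hb1⟩ := h1
    have hb2 := pow_eq_zero_iff hk |>.1 hb1
    have : b = a₀ := by
      field_simp at hb2
      linarith
    exact (Finset.mem_erase.1 hb).1 this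

open Polynomial in
lemma ratl_uniq (S : Finset ℝ) (n c : ℝ → ℝ) (K : ℝ) (hS : ∀ a ∈ S, -1 < a)
    (hsum : ∑ a ∈ S, n a = 0)
    (h : ∀ t ∈ Set.Ioo (0:ℝ) 1,
      ∑ a ∈ S, (n a * (a / (1 + t * a)) + c a * ((1 - 2 * t - a * t ^ 2) / (1 + t * a) ^ 2)) = K) :
    ∀ a ∈ S, n a = 0 ∧ c a = 0 := by
  classical
  have hne : ∀ t ∈ Set.Ioo (0:ℝ) 1, ∀ a ∈ S, (1 + t * a) ≠ 0 := by
    intro t ht a haS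
    have := hS a haS
    have h1 := ht.1
    have h2 := ht.2
    nlinarith
  have hc : ∀ a ∈ S, a ≠ 0 → c a = 0 := by
    intro a ha h0
    have := pole_lemma S 2 two_ne_zero
      (fun a => C (n a * a) * (1 + X * C a) + C (c a) * (1 - 2 * X - C a * X ^ 2)) (C (-K)) hS
      (by
        intro t ht
        rw [eval_C, ← sub_eq_add_neg, sub_eq_zero, ← h t ht]
        apply Finset.sum_congr rfl
        intro a haS
        have := hne t ht a haS
        simp
        field_simp) a ha h0
    simp only [eval_add, eval_sub, eval_mul, eval_C, eval_X, eval_one, eval_pow, eval_ofNat] at this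
    have h1 := hS a ha
    have h2 : c a * (1 + a) = 0 := by
      field_simp at this
      nlinarith
    rcases mul_eq_zero.1 h2 with h3 | h3
    · exact h3
    · linarith
  have hn : ∀ a ∈ S, a ≠ 0 → n a = 0 := by
    intro a ha h0
    have := pole_lemma S 1 one_ne_zero
      (fun a => C (n a * a) + (if a = 0 then C (c a) * (1 - 2 * X) else 0)) (C (-K)) hS
      (by
        intro t ht
        rw [eval_C, ← sub_eq_add_neg, sub_eq_zero, ← h t ht]
        apply Finset.sum_congr rfl
        intro a haS
        have := hne t ht a haS
        by_cases h : a = 0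
        · subst h; simp
        · simp [h, hc a haS h]; field_simp) a ha h0
    simpa [h0] using this
  intro a ha
  by_cases h0 : a = 0
  · subst h0
    constructor
    · rw [Finset.sum_eq_single 0 (fun b hb hb0 => hn b hb hb0) (fun h => absurd ha h)] at hsum
      exact hsum
    · have hh : ∀ t ∈ Set.Ioo (0:ℝ) 1, c 0 * (1 - 2 * t) = K := by
        intro t ht
        rw [← h t ht, Finset.sum_eq_single 0]
        · simp
        · intro b hb hb0; simp [hn b hb hb0, hc b hb hb0]
        · intro h; exact absurd ha h
      have h1 := hh (1/2) ⟨by norm_num, by norm_num⟩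
      have h2 := hh (1/4) ⟨by norm_num, by norm_num⟩
      linarith
  · exact ⟨hn a ha h0, hc a ha h0⟩

/-- log of one-dimensional Hellinger factor -/
def lK (p c t : ℝ) : ℝ :=
  t * (Real.log p / 2) - Real.log (1 + t * (p - 1)) / 2 - t * (1 - t) * c / (1 + t * (p - 1)) / 2

lemma lK_deriv (p c t : ℝ) (hp : 0 < p) (ht : t ∈ Set.Ioo (0:ℝ) 1) :
    HasDerivAt (lK p c) (Real.log p / 2 - ((p - 1) / (1 + t * (p - 1))) / 2
      - c * ((1 - 2 * t - (p - 1) * t ^ 2) / (1 + t * (p - 1)) ^ 2) / 2) t := by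
  have hne : 1 + t * (p - 1) ≠ 0 := by
    have h1 := ht.1
    have h2 := ht.2
    nlinarith
  have h1 : HasDerivAt (fun t : ℝ => 1 + t * (p - 1)) (p - 1) t := by
    simpa using ((hasDerivAt_id t).mul_const (p - 1)).const_add 1
  have h2 : HasDerivAt (fun t : ℝ => t * (1 - t) * c) ((1 * (1 - t) + t * (-1)) * c) t := by
    exact (((hasDerivAt_id t).mul ((hasDerivAt_id t).const_sub 1)).mul_const c)
  have h3 := (((hasDerivAt_id t).mul_const (Real.log p / 2)).sub ((h1.log hne).div_const 2)).sub
    ((h2.div h1 hne).div_const 2)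
  refine h3.congr_deriv ?_
  field_simp
  ring

lemma fiber_sum {ι : Type*} [Fintype ι] (S : Finset ℝ) (a : ι → ℝ) (hS : ∀ i, a i ∈ S)
    (w : ι → ℝ) (F : ℝ → ℝ) :
    ∑ i, w i * F (a i) = ∑ x ∈ S, (∑ i with a i = x, w i) * F x := by
  classical
  rw [← Finset.sum_fiberwise_of_maps_to (s := Finset.univ) (t := S) (g := a) (fun i _ => hS i)]
  apply Finset.sum_congr rfl
  intro x _
  rw [Finset.sum_mul]
  apply Finset.sum_congr rfl
  intro i hi
  rw [(Finset.mem_filter.1 hi).2]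

lemma lK_uniq {ι : Type*} [Fintype ι] (p q c d : ι → ℝ) (hp : ∀ i, 0 < p i) (hq : ∀ i, 0 < q i)
    (h : ∀ t ∈ Set.Ioo (0:ℝ) 1, ∑ i, lK (p i) (c i) t = ∑ i, lK (q i) (d i) t) (x : ℝ) :
    (Finset.card {i | p i = x} = Finset.card {i | q i = x}) ∧
    ∑ i with p i = x, c i = ∑ i with q i = x, d i := by
  classical
  have hD : ∀ t ∈ Set.Ioo (0:ℝ) 1,
      ∑ i, (Real.log (p i) / 2 - ((p i - 1) / (1 + t * (p i - 1))) / 2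
      - c i * ((1 - 2 * t - (p i - 1) * t ^ 2) / (1 + t * (p i - 1)) ^ 2) / 2) =
      ∑ i, (Real.log (q i) / 2 - ((q i - 1) / (1 + t * (q i - 1))) / 2
      - d i * ((1 - 2 * t - (q i - 1) * t ^ 2) / (1 + t * (q i - 1)) ^ 2) / 2) := by
    intro t ht
    have h1 := HasDerivAt.fun_sum (u := Finset.univ) (fun i _ => lK_deriv (p i) (c i) t (hp i) ht)
    have h2 := HasDerivAt.fun_sum (u := Finset.univ) (fun i _ => lK_deriv (q i) (d i) t (hq i) ht)
    refine h1.unique (h2.congr_of_eventuallyEq ?_)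
    filter_upwards [isOpen_Ioo.mem_nhds ht] with s hs using h s hs
  set S : Finset ℝ := Finset.univ.image (fun i => p i - 1) ∪ Finset.univ.image (fun i => q i - 1)
    with hSdef
  have hSp : ∀ i, p i - 1 ∈ S := fun i => by simp [hSdef]
  have hSq : ∀ i, q i - 1 ∈ S := fun i => by simp [hSdef]
  have key := ratl_uniq S
    (fun a => (∑ i with p i - 1 = a, (1:ℝ)) - ∑ i with q i - 1 = a, (1:ℝ))
    (fun a => (∑ i with p i - 1 = a, c i) - ∑ i with q i - 1 = a, d i)
    (∑ i, Real.log (p i) - ∑ i, Real.log (q i))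
    (by
      intro a ha
      simp only [hSdef, Finset.mem_union, Finset.mem_image, Finset.mem_univ, true_and] at ha
      rcases ha with ⟨i, rfl⟩ | ⟨i, rfl⟩
      · linarith [hp i]
      · linarith [hq i])
    (by
      have h1 := fiber_sum S (fun i => p i - 1) hSp (fun _ => 1) (fun _ => 1)
      have h2 := fiber_sum S (fun i => q i - 1) hSq (fun _ => 1) (fun _ => 1)
      simp only [mul_one] at h1 h2
      rw [Finset.sum_sub_distrib, ← h1, ← h2, sub_self])
    (by
      intro t ht
      have h1 := fiber_sum S (fun i => p i - 1) hSp (fun _ => 1) (fun a => a / (1 + t * a))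
      have h2 := fiber_sum S (fun i => q i - 1) hSq (fun _ => 1) (fun a => a / (1 + t * a))
      have h3 := fiber_sum S (fun i => p i - 1) hSp c
        (fun a => ((1 - 2 * t - a * t ^ 2) / (1 + t * a) ^ 2))
      have h4 := fiber_sum S (fun i => q i - 1) hSq d
        (fun a => ((1 - 2 * t - a * t ^ 2) / (1 + t * a) ^ 2))
      have h5 := hD t ht
      simp only [Finset.sum_sub_distrib, ← Finset.sum_div] at h5
      simp only [one_mul] at h1 h2
      rw [Finset.sum_add_distrib]
      rw [Finset.sum_congr rfl (fun a _ => sub_mul _ _ (a / (1 + t * a))),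
        Finset.sum_congr rfl (fun a _ => sub_mul _ _ ((1 - 2 * t - a * t ^ 2) / (1 + t * a) ^ 2)),
        Finset.sum_sub_distrib, Finset.sum_sub_distrib]
      rw [← h1, ← h2, ← h3, ← h4]
      linarith)
  have hpx : ∀ i, p i - 1 = x - 1 ↔ p i = x := fun i => sub_left_inj
  have hqx : ∀ i, q i - 1 = x - 1 ↔ q i = x := fun i => sub_left_inj
  by_cases hx : x - 1 ∈ S
  · obtain ⟨h1, h2⟩ := key _ hx
    simp only [hpx, hqx] at h1 h2
    simp only [Finset.sum_const, nsmul_eq_mul, mul_one] at h1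
    exact ⟨by exact_mod_cast sub_eq_zero.1 h1, sub_eq_zero.1 h2⟩
  · have e1 : (Finset.univ.filter fun i => p i = x) = ∅ := by
      apply Finset.filter_eq_empty_iff.2
      intro i _ hi
      exact hx (hi ▸ hSp i)
    have e2 : (Finset.univ.filter fun i => q i = x) = ∅ := by
      apply Finset.filter_eq_empty_iff.2
      intro i _ hi
      exact hx (hi ▸ hSq i)
    rw [e1, e2]; simp

lemma exists_perm_of_card {ι : Type*} [Fintype ι] (p q : ι → ℝ)
    (h : ∀ x, Finset.card {i | p i = x} = Finset.card {i | q i = x}) :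
    ∃ σ : Equiv.Perm ι, ∀ i, q (σ i) = p i := by
  classical
  have e : ∀ x, Nonempty ({i // p i = x} ≃ {i // q i = x}) := by
    intro x
    apply Fintype.card_eq.1
    rw [Fintype.card_subtype, Fintype.card_subtype, h x]
  replace e := fun x => (e x).some
  refine ⟨(Equiv.sigmaFiberEquiv p).symm.trans
    ((Equiv.sigmaCongrRight e).trans (Equiv.sigmaFiberEquiv q)), fun i => ?_⟩
  exact (e (p i) ⟨i, rfl⟩).2

/-- block Householder -/
lemma exists_house {ι : Type*} [Fintype ι] [DecidableEq ι] (p u w : ι → ℝ)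
    (h : ∀ x, ∑ i with p i = x, u i ^ 2 = ∑ i with p i = x, w i ^ 2) :
    ∃ Q : Matrix ι ι ℝ, Q * Q.transpose = 1 ∧ Q.mulVec u = w ∧ ∀ i j, p i ≠ p j → Q i j = 0 := by
  set d : ι → ℝ := u - w with hd
  set n : ℝ → ℝ := fun x => ∑ i with p i = x, d i ^ 2 with hn
  have hz : ∀ i, n (p i) = 0 → d i = 0 := by
    intro i hi
    have := (Finset.sum_eq_zero_iff_of_nonneg (fun j _ => sq_nonneg (d j))).1 hi i (by simp)
    simpa using this
  set E : Matrix ι ι ℝ := Matrix.of fun i j => if p j = p i then 2 * d i * d j / n (p i) else 0 with hE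
  have hEa : ∀ i j, E i j = if p j = p i then 2 * d i * d j / n (p i) else 0 := fun i j => rfl
  have hEt : E.transpose = E := by
    ext i j
    simp only [Matrix.transpose_apply, hEa]
    by_cases hij : p i = p j
    · rw [if_pos hij, if_pos hij.symm, hij]; ring
    · rw [if_neg hij, if_neg (Ne.symm hij)]
  have hEE : E * E = 2 • E := by
    ext i k
    simp only [Matrix.mul_apply, Matrix.smul_apply, hEa]
    by_cases hik : p k = p i
    · have : ∀ j, ((if p j = p i then 2 * d i * d j / n (p i) else 0) *
        (if p k = p j then 2 * d j * d k / n (p j) else 0)) =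
        if p j = p i then (4 * d i * d k / n (p i) ^ 2) * d j ^ 2 else 0 := by
        intro j
        by_cases hj : p j = p i
        · rw [if_pos hj, if_pos (hik.trans hj.symm), if_pos hj, hj]; ring
        · rw [if_neg hj, if_neg hj, zero_mul]
      rw [Finset.sum_congr rfl (fun j _ => this j), ← Finset.sum_filter, ← Finset.mul_sum,
        if_pos hik]
      change _ * n (p i) = _
      by_cases h0 : n (p i) = 0
      · simp [h0]
      · simp only [nsmul_eq_mul]; field_simp; push_cast; ring
    · rw [if_neg hik, smul_zero]
      apply Finset.sum_eq_zero
      intro j _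
      by_cases hj : p j = p i
      · rw [if_neg (show ¬ p k = p j from fun h => hik (h.trans hj)), mul_zero]
      · rw [if_neg hj, zero_mul]
  refine ⟨1 - E, ?_, ?_, ?_⟩
  · rw [Matrix.transpose_sub, hEt, Matrix.transpose_one, sub_mul, mul_sub, mul_sub, hEE]
    simp only [one_mul, mul_one, two_smul]
    abel
  · rw [Matrix.sub_mulVec, Matrix.one_mulVec]
    ext i
    have : E.mulVec u i = d i := by
      simp only [Matrix.mulVec, dotProduct, hEa]
      have : ∀ j, (if p j = p i then 2 * d i * d j / n (p i) else 0) * u j =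
        if p j = p i then (d i / n (p i)) * (2 * d j * u j) else 0 := by
        intro j; split_ifs <;> ring
      rw [Finset.sum_congr rfl (fun j _ => this j), ← Finset.sum_filter, ← Finset.mul_sum]
      have h2 : ∑ j with p j = p i, 2 * d j * u j = n (p i) := by
        have : ∑ j with p j = p i, 2 * d j * u j - n (p i) =
          ∑ j with p j = p i, u j ^ 2 - ∑ j with p j = p i, w j ^ 2 := by
          rw [hn, ← Finset.sum_sub_distrib, ← Finset.sum_sub_distrib]
          apply Finset.sum_congr rfl
          intro j _
          simp only [hd, Pi.sub_apply]; ring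
        rw [h, sub_self] at this
        linarith
      rw [h2]
      by_cases h0 : n (p i) = 0
      · rw [hz i h0, h0]; simp
      · field_simp
    rw [Pi.sub_apply, this, hd, Pi.sub_apply]; ring
  · intro i j hij
    have : i ≠ j := fun h => hij (h ▸ rfl)
    simp [Matrix.sub_apply, hEa, this, Ne.symm hij]

instance {N : ℕ} : IsProbabilityMeasure (stdGaussianPi N) := by
  unfold stdGaussianPi; infer_instance

lemma meas_aff {N : ℕ} (A : Matrix (Fin N) (Fin N) ℝ) (b : Fin N → ℝ) :
    Measurable (fun z => A.mulVec z + b) := by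
  have : Continuous (fun z => A.mulVec z + b) := by fun_prop
  exact this.measurable

lemma std_rot {N : ℕ} (V : Matrix (Fin N) (Fin N) ℝ) (hV : V * V.transpose = 1) :
    (stdGaussianPi N).map (fun z => V.mulVec z) = stdGaussianPi N := by
  have hV' : V.transpose * V = 1 := mul_eq_one_comm.1 hV
  let L : EuclideanSpace ℝ (Fin N) →ₗ[ℝ] EuclideanSpace ℝ (Fin N) := Matrix.toEuclideanLin V
  have hn : ∀ x, ‖L x‖ = ‖x‖ := by
    intro x
    rw [← sq_eq_sq₀ (norm_nonneg _) (norm_nonneg _), EuclideanSpace.real_norm_sq_eq,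
      EuclideanSpace.real_norm_sq_eq]
    have h1 : ∑ i, L x i ^ 2 = (V.mulVec x.ofLp) ⬝ᵥ (V.mulVec x.ofLp) := by
      simp only [dotProduct, sq]; rfl
    have h2 : ∑ i, x i ^ 2 = x.ofLp ⬝ᵥ x.ofLp := by
      simp only [dotProduct, sq]
    rw [h1, h2, Matrix.dotProduct_mulVec, Matrix.vecMul_mulVec, hV', Matrix.vecMul_one]
  let I : EuclideanSpace ℝ (Fin N) →ₗᵢ[ℝ] EuclideanSpace ℝ (Fin N) := ⟨L, hn⟩
  let E := I.toLinearIsometryEquiv rfl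
  have h1 := stdGaussian_map E
  rw [← map_pi_eq_stdGaussian] at h1
  have h2 := congrArg (fun m => Measure.map (WithLp.ofLp) m) h1
  simp only at h2
  have m1 : Measurable (WithLp.toLp 2 : (Fin N → ℝ) → EuclideanSpace ℝ (Fin N)) := by fun_prop
  have m2 : Measurable (WithLp.ofLp : EuclideanSpace ℝ (Fin N) → (Fin N → ℝ)) := by fun_prop
  have m3 : Measurable E := E.continuous.measurable
  rw [Measure.map_map m2 m3, Measure.map_map (m2.comp m3) m1, Measure.map_map m2 m1] at h2
  have e1 : (WithLp.ofLp ∘ (WithLp.toLp 2 : (Fin N → ℝ) → EuclideanSpace ℝ (Fin N))) = id := rfl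
  rw [e1, Measure.map_id] at h2
  exact h2

/-- density of Gaussian with precision p -/
lemma pdf_eq (m p : ℝ) (hp : 0 < p) (x : ℝ) :
    gaussianPDFReal m (Real.toNNReal p⁻¹) x =
      Real.exp (Real.log p / 2 - Real.log (2 * Real.pi) / 2 - p * (x - m) ^ 2 / 2) := by
  have hpi := Real.pi_pos
  rw [gaussianPDFReal_def]
  simp only [Real.coe_toNNReal _ (inv_pos.2 hp).le]
  have h0 : 0 < Real.sqrt (2 * Real.pi * p⁻¹) := by positivity
  rw [← Real.exp_log (show 0 < (√(2 * Real.pi * p⁻¹))⁻¹ * Real.exp (-(x - m) ^ 2 / (2 * p⁻¹)) by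
    positivity), Real.log_mul (by positivity) (by positivity), Real.log_inv, Real.log_sqrt
    (by positivity), Real.log_exp, Real.log_mul (by positivity) (by positivity), Real.log_inv]
  congr 1
  field_simp
  ring

/-- likelihood ratio -/
def fd (m p x : ℝ) : ℝ := Real.exp (Real.log p / 2 - p * (x - m) ^ 2 / 2 + x ^ 2 / 2)

lemma fd_nonneg (m p x : ℝ) : 0 ≤ fd m p x := Real.exp_nonneg _

lemma fd_meas (m p : ℝ) : Measurable (fd m p) := by unfold fd; fun_prop

lemma g01 : gaussianReal 0 1 = gaussianReal 0 (Real.toNNReal (1:ℝ)⁻¹) := by simp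

lemma v_ne (p : ℝ) (hp : 0 < p) : Real.toNNReal p⁻¹ ≠ 0 := by
  simpa using hp

lemma gauss_density (m p : ℝ) (hp : 0 < p) :
    gaussianReal m (Real.toNNReal p⁻¹) =
      (gaussianReal 0 1).withDensity (fun x => ENNReal.ofReal (fd m p x)) := by
  rw [g01, gaussianReal_of_var_ne_zero _ (v_ne p hp), gaussianReal_of_var_ne_zero _ (v_ne 1 one_pos),
    ← withDensity_mul _ (measurable_gaussianPDF _ _) (by
      exact ENNReal.measurable_ofReal.comp (fd_meas m p))]
  congr 1
  ext x
  rw [Pi.mul_apply, gaussianPDF, gaussianPDF, ← ENNReal.ofReal_mul (gaussianPDFReal_nonneg _ _ _),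
    pdf_eq _ _ hp, pdf_eq _ _ one_pos, fd, ← Real.exp_add]
  congr 2
  simp
  ring

lemma hell_one (m p t : ℝ) (hp : 0 < p) (ht : t ∈ Set.Ioo (0:ℝ) 1) :
    ∫⁻ x, ENNReal.ofReal (fd m p x ^ t) ∂(gaussianReal 0 1) =
      ENNReal.ofReal (Real.exp (lK p (p * m ^ 2) t)) := by
  have hq : 0 < 1 + t * (p - 1) := by
    have h1 := ht.1
    have h2 := ht.2
    nlinarith
  set q := 1 + t * (p - 1) with hqd
  rw [g01, gaussianReal_of_var_ne_zero _ (v_ne 1 one_pos),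
    lintegral_withDensity_eq_lintegral_mul _ (measurable_gaussianPDF _ _) (by
      exact ENNReal.measurable_ofReal.comp ((fd_meas m p).pow_const t))]
  have : ∀ x, (gaussianPDF 0 (Real.toNNReal (1:ℝ)⁻¹) * fun x => ENNReal.ofReal (fd m p x ^ t)) x =
      ENNReal.ofReal (Real.exp (lK p (p * m ^ 2) t)) *
        gaussianPDF (t * p * m / q) (Real.toNNReal q⁻¹) x := by
    intro x
    rw [Pi.mul_apply, gaussianPDF, gaussianPDF, ← ENNReal.ofReal_mul (gaussianPDFReal_nonneg _ _ _),
      ← ENNReal.ofReal_mul (Real.exp_nonneg _),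
      pdf_eq _ _ hq, pdf_eq _ _ one_pos, fd, ← Real.exp_add, ← Real.exp_mul, ← Real.exp_add]
    congr 2
    rw [lK, ← hqd, Real.log_one]
    have hpq : t * p = q - 1 + t := by rw [hqd]; ring
    have hpe : p = (q - 1 + t) / t := by rw [← hpq]; field_simp [ht.1.ne']
    have ht0 := ht.1.ne'
    generalize Real.log p = lp
    generalize Real.log q = lq
    clear_value q
    subst hpe
    field_simp
    ring
  rw [lintegral_congr this, lintegral_const_mul _ (measurable_gaussianPDF _ _),
    lintegral_gaussianPDF_eq_one _ (v_ne q hq), mul_one]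

/-- product Gaussian with means `m` and precisions `p` -/
def Gpi {N : ℕ} (m p : Fin N → ℝ) : Measure (Fin N → ℝ) :=
  Measure.pi (fun i => gaussianReal (m i) (Real.toNNReal (p i)⁻¹))

def Fd {N : ℕ} (m p x : Fin N → ℝ) : ℝ := ∏ i, fd (m i) (p i) (x i)

lemma Fd_meas {N : ℕ} (m p : Fin N → ℝ) : Measurable (Fd m p) := by
  unfold Fd
  exact Finset.measurable_prod _ (fun i _ => (fd_meas _ _).comp (measurable_pi_apply i))

lemma Fd_pos {N : ℕ} (m p x : Fin N → ℝ) : 0 < Fd m p x :=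
  Finset.prod_pos (fun _ _ => Real.exp_pos _)

lemma lint_std {N : ℕ} (X : Fin N → ℝ → ℝ≥0∞) (hX : ∀ i, Measurable (X i)) :
    ∫⁻ x, ∏ i, X i (x i) ∂(stdGaussianPi N) = ∏ i, ∫⁻ x, X i x ∂(gaussianReal 0 1) := by
  have h1 : iIndepFun (fun i (x : Fin N → ℝ) => X i (x i)) (stdGaussianPi N) :=
    iIndepFun_pi (fun i => (hX i).aemeasurable)
  rw [lintegral_prod_eq_prod_lintegral_of_indepFun Finset.univ _ h1
    (fun i => (hX i).comp (measurable_pi_apply i))]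
  apply Finset.prod_congr rfl
  intro i _
  exact (measurePreserving_eval (fun _ : Fin N => gaussianReal 0 1) i).lintegral_comp (hX i)

lemma Gpi_density {N : ℕ} (m p : Fin N → ℝ) (hp : ∀ i, 0 < p i) :
    Gpi m p = (stdGaussianPi N).withDensity (fun x => ENNReal.ofReal (Fd m p x)) := by
  apply Measure.pi_eq
  intro s hs
  have hbox : MeasurableSet (Set.univ.pi s) := MeasurableSet.univ_pi hs
  rw [withDensity_apply _ hbox, ← lintegral_indicator hbox]
  have : ∀ x, (Set.univ.pi s).indicator (fun x => ENNReal.ofReal (Fd m p x)) x =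
      ∏ i, (s i).indicator (fun y => ENNReal.ofReal (fd (m i) (p i) y)) (x i) := by
    intro x
    by_cases hx : x ∈ Set.univ.pi s
    · rw [Set.indicator_of_mem hx, Fd, ENNReal.ofReal_prod_of_nonneg (fun _ _ => fd_nonneg _ _ _)]
      apply Finset.prod_congr rfl
      intro i _
      rw [Set.indicator_of_mem (hx i (Set.mem_univ i))]
    · rw [Set.indicator_of_notMem hx]
      simp only [Set.mem_pi, Set.mem_univ, true_implies, not_forall] at hx
      obtain ⟨i, hi⟩ := hx
      exact (Finset.prod_eq_zero (Finset.mem_univ i) (Set.indicator_of_notMem hi _)).symm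
  rw [lintegral_congr this, lint_std (fun i => (s i).indicator
    (fun y => ENNReal.ofReal (fd (m i) (p i) y)))
    (fun i => (ENNReal.measurable_ofReal.comp (fd_meas _ _)).indicator (hs i))]
  apply Finset.prod_congr rfl
  intro i _
  rw [lintegral_indicator (hs i), gauss_density _ _ (hp i), withDensity_apply _ (hs i)]

lemma hell_pi {N : ℕ} (m p : Fin N → ℝ) (hp : ∀ i, 0 < p i) (t : ℝ) (ht : t ∈ Set.Ioo (0:ℝ) 1) :
    ∫⁻ x, ENNReal.ofReal (Fd m p x ^ t) ∂(stdGaussianPi N) =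
      ENNReal.ofReal (Real.exp (∑ i, lK (p i) (p i * m i ^ 2) t)) := by
  have : ∀ x, ENNReal.ofReal (Fd m p x ^ t) = ∏ i, ENNReal.ofReal (fd (m i) (p i) (x i) ^ t) := by
    intro x
    rw [Fd, ← Real.finsetProd_rpow _ _ (fun _ _ => fd_nonneg _ _ _),
      ENNReal.ofReal_prod_of_nonneg (fun _ _ => Real.rpow_nonneg (fd_nonneg _ _ _) _)]
  rw [lintegral_congr this, lint_std (fun i y => ENNReal.ofReal (fd (m i) (p i) y ^ t))
    (fun i => ENNReal.measurable_ofReal.comp ((fd_meas _ _).pow_const t)), Real.exp_sum,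
    ENNReal.ofReal_prod_of_nonneg (fun _ _ => Real.exp_nonneg _)]
  exact Finset.prod_congr rfl (fun i _ => hell_one _ _ _ (hp i) ht)

/-- data processing for Hellinger integrals -/
lemma dpi {X Y : Type*} [MeasurableSpace X] [MeasurableSpace Y] (κ : Kernel X Y) [IsMarkovKernel κ]
    (β : Measure X) (β' : Measure Y) (f : X → ℝ) (g : Y → ℝ) (hf : Measurable f)
    (hg : Measurable g) (hf0 : ∀ x, 0 < f x) (hg0 : ∀ y, 0 < g y)
    (h1 : β.bind κ = β')
    (h2 : (β.withDensity (fun x => ENNReal.ofReal (f x))).bind κ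
      = β'.withDensity (fun y => ENNReal.ofReal (g y)))
    (t : ℝ) (ht : t ∈ Set.Ioo (0:ℝ) 1) :
    ∫⁻ x, ENNReal.ofReal (f x ^ t) ∂β ≤ ∫⁻ y, ENNReal.ofReal (g y ^ t) ∂β' := by
  obtain ⟨ht0, ht1⟩ := ht
  have mf : Measurable fun x => ENNReal.ofReal (f x) := ENNReal.measurable_ofReal.comp hf
  have mg : Measurable fun y => ENNReal.ofReal (g y) := ENNReal.measurable_ofReal.comp hg
  have ma : Measurable fun y => ENNReal.ofReal (t * g y ^ (t - 1)) :=
    ENNReal.measurable_ofReal.comp ((hg.pow_const _).const_mul _)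
  have mb : Measurable fun y => ENNReal.ofReal ((1 - t) * g y ^ t) :=
    ENNReal.measurable_ofReal.comp ((hg.pow_const _).const_mul _)
  have hk : AEMeasurable (fun x => κ x) β := κ.measurable.aemeasurable
  have e1 : ∫⁻ y, ENNReal.ofReal (g y ^ t) ∂β' =
      ∫⁻ y, ENNReal.ofReal (t * g y ^ (t - 1)) ∂(β'.withDensity (fun y => ENNReal.ofReal (g y)))
      + ∫⁻ y, ENNReal.ofReal ((1 - t) * g y ^ t) ∂β' := by
    rw [lintegral_withDensity_eq_lintegral_mul _ mg ma, ← lintegral_add_left (mg.mul ma)]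
    apply lintegral_congr
    intro y
    have hy := hg0 y
    rw [Pi.mul_apply, ← ENNReal.ofReal_mul hy.le, ← ENNReal.ofReal_add
      (by positivity) (mul_nonneg (by linarith) (by positivity))]
    congr 1
    rw [Real.rpow_sub_one hy.ne']
    field_simp
    ring
  rw [e1, ← h2, ← h1, Measure.lintegral_bind κ.measurable.aemeasurable ma.aemeasurable,
    Measure.lintegral_bind hk mb.aemeasurable,
    lintegral_withDensity_eq_lintegral_mul _ mf ma.lintegral_kernel,
    ← lintegral_add_left (mf.mul ma.lintegral_kernel)]
  apply lintegral_mono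
  intro x
  simp only [Pi.mul_apply]
  rw [← lintegral_const_mul _ ma, ← lintegral_add_left (ma.const_mul _)]
  calc ENNReal.ofReal (f x ^ t) = ∫⁻ y, ENNReal.ofReal (f x ^ t) ∂(κ x) := by simp
    _ ≤ _ := by
      apply lintegral_mono
      intro y
      have hy := hg0 y
      have hx := hf0 x
      simp only
      rw [← ENNReal.ofReal_mul hx.le, ← ENNReal.ofReal_add
        (by positivity) (mul_nonneg (by linarith) (by positivity))]
      apply ENNReal.ofReal_le_ofReal
      have := Real.geom_mean_le_arith_mean2_weighted ht0.le (by linarith : 0 ≤ 1 - t)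
        (show 0 ≤ g y ^ (t - 1) * f x by positivity) (show 0 ≤ g y ^ t by positivity) (by ring)
      refine le_trans (le_of_eq ?_) (this.trans (le_of_eq (by ring)))
      rw [Real.mul_rpow (by positivity) hx.le, ← Real.rpow_mul hy.le, ← Real.rpow_mul hy.le,
        mul_right_comm, ← Real.rpow_add hy, show (t - 1) * t + t * (1 - t) = 0 by ring,
        Real.rpow_zero, one_mul]


lemma map_diag {N : ℕ} (s m : Fin N → ℝ) :
    (stdGaussianPi N).map (fun z => (Matrix.diagonal s).mulVec z + m) =
      Gpi m (fun i => (s i ^ 2)⁻¹) := by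
  have e : (fun z => (Matrix.diagonal s).mulVec z + m) = fun z i => s i * z i + m i := by
    ext z i
    simp [Matrix.mulVec_diagonal]
  have hm : ∀ i, Measurable (fun y : ℝ => s i * y + m i) := fun i => by fun_prop
  have h1 : ∀ i, (gaussianReal 0 1).map (fun y : ℝ => s i * y + m i) =
      gaussianReal (m i) (Real.toNNReal (((s i) ^ 2)⁻¹)⁻¹) := by
    intro i
    have := Measure.map_map (μ := gaussianReal 0 1) (measurable_add_const (m i))
      (measurable_const_mul (s i))
    rw [show (fun y : ℝ => s i * y + m i) = (fun y => y + m i) ∘ (fun y => s i * y) from rfl,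
      ← this, gaussianReal_map_const_mul, gaussianReal_map_add_const]
    congr 1
    · simp
    · rw [inv_inv, mul_one]
      ext
      simp [sq_nonneg]
  have : ∀ i, SigmaFinite ((gaussianReal 0 1).map (fun y : ℝ => s i * y + m i)) := by
    intro i; rw [h1 i]; infer_instance
  rw [e, stdGaussianPi, Measure.pi_map_pi (fun i => (hm i).aemeasurable), Gpi]
  congr 1
  ext1 i
  exact h1 i

lemma svd_lemma {N : ℕ} (C : Matrix (Fin N) (Fin N) ℝ) (hC : C.det ≠ 0) :
    ∃ (U W : Matrix (Fin N) (Fin N) ℝ) (s : Fin N → ℝ), U * U.transpose = 1 ∧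
      W * W.transpose = 1 ∧ (∀ i, 0 < s i) ∧ C = U * Matrix.diagonal s * W := by
  have hu : IsUnit C := (Matrix.isUnit_iff_isUnit_det C).2 (isUnit_iff_ne_zero.2 hC)
  have hM : (C * C.transpose).PosDef := by
    have := Matrix.PosDef.mul_conjTranspose_self C (Matrix.vecMul_injective_of_isUnit hu)
    rwa [Matrix.conjTranspose_eq_transpose_of_trivial] at this
  have hsp := hM.1.spectral_theorem
  have hev := hM.eigenvalues_pos
  set l := hM.1.eigenvalues with hl
  set U : Matrix (Fin N) (Fin N) ℝ := (hM.1.eigenvectorUnitary : Matrix (Fin N) (Fin N) ℝ) with hU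
  have hUU : U * U.transpose = 1 := by
    have := Unitary.mul_star_self_of_mem hM.1.eigenvectorUnitary.2
    rwa [Matrix.star_eq_conjTranspose, Matrix.conjTranspose_eq_transpose_of_trivial] at this
  have hUU' : U.transpose * U = 1 := mul_eq_one_comm.1 hUU
  have hsp' : C * C.transpose = U * Matrix.diagonal l * U.transpose := by
    rw [Unitary.conjStarAlgAut_apply] at hsp
    rw [Matrix.star_eq_conjTranspose, Matrix.conjTranspose_eq_transpose_of_trivial] at hsp
    exact hsp
  have hs : ∀ i, 0 < Real.sqrt (l i) := fun i => Real.sqrt_pos.2 (hev i)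
  refine ⟨U, Matrix.diagonal (fun i => (Real.sqrt (l i))⁻¹) * U.transpose * C,
    fun i => Real.sqrt (l i), hUU, ?_, hs, ?_⟩
  · rw [Matrix.transpose_mul, Matrix.transpose_mul, Matrix.transpose_transpose,
      Matrix.diagonal_transpose]
    calc _ = Matrix.diagonal (fun i => (Real.sqrt (l i))⁻¹) * U.transpose * (C * C.transpose)
        * U * Matrix.diagonal (fun i => (Real.sqrt (l i))⁻¹) := by simp only [Matrix.mul_assoc]
      _ = Matrix.diagonal (fun i => (Real.sqrt (l i))⁻¹) * (U.transpose * U) * Matrix.diagonal l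
        * (U.transpose * U) * Matrix.diagonal (fun i => (Real.sqrt (l i))⁻¹) := by
          rw [hsp']; simp only [Matrix.mul_assoc]
      _ = 1 := by
        rw [hUU', mul_one, mul_one, Matrix.diagonal_mul_diagonal, Matrix.diagonal_mul_diagonal,
          ← Matrix.diagonal_one]
        congr 1
        ext i
        have h1 := hs i
        have h2 := Real.mul_self_sqrt (hev i).le
        field_simp
        nlinarith
  · have h1 : Matrix.diagonal (fun i => Real.sqrt (l i)) *
        Matrix.diagonal (fun i => (Real.sqrt (l i))⁻¹) = 1 := by
      rw [Matrix.diagonal_mul_diagonal, ← Matrix.diagonal_one]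
      congr 1
      ext i
      exact mul_inv_cancel₀ (hs i).ne'
    calc C = (U * U.transpose) * C := by rw [hUU, one_mul]
      _ = U * (Matrix.diagonal (fun i => Real.sqrt (l i)) *
        Matrix.diagonal (fun i => (Real.sqrt (l i))⁻¹)) * U.transpose * C := by
          rw [h1, mul_one]
      _ = _ := by simp only [Matrix.mul_assoc]

/-- map of standard Gaussian unaffected by pre-rotation -/
lemma map_rot {N : ℕ} (V : Matrix (Fin N) (Fin N) ℝ) (hV : V * V.transpose = 1)
    (F : (Fin N → ℝ) → (Fin N → ℝ)) (hF : Measurable F) :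
    (stdGaussianPi N).map (fun z => F (V.mulVec z)) = (stdGaussianPi N).map F := by
  have hm : Measurable (fun z : Fin N → ℝ => V.mulVec z) := by simpa using meas_aff V 0
  conv_rhs => rw [← std_rot V hV]
  rw [Measure.map_map hF hm]
  rfl

lemma normal_form {N : ℕ} (μ : Fin 2 → Measure (Fin N → ℝ)) (hμ : ∀ i, IsNondegGaussian (μ i)) :
    ∃ (B : Matrix (Fin N) (Fin N) ℝ) (b s m : Fin N → ℝ), B.det ≠ 0 ∧ (∀ i, 0 < s i) ∧
      μ 1 = (stdGaussianPi N).map (fun z => B.mulVec z + b) ∧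
      μ 0 = (stdGaussianPi N).map (fun z => B.mulVec ((Matrix.diagonal s).mulVec z + m) + b) := by
  obtain ⟨A0, m0, hA0, h0⟩ := hμ 0
  obtain ⟨A1, m1, hA1, h1⟩ := hμ 1
  have hu : IsUnit A1.det := isUnit_iff_ne_zero.2 hA1
  obtain ⟨U, W, s, hU, hW, hs, hC⟩ := svd_lemma (A1⁻¹ * A0) (by
    rw [Matrix.det_mul]
    exact mul_ne_zero (Matrix.isUnit_nonsing_inv_det A1 hu).ne_zero hA0)
  have hA : A0 = A1 * U * Matrix.diagonal s * W := by
    rw [Matrix.mul_assoc, Matrix.mul_assoc, ← Matrix.mul_assoc U, ← hC, ← Matrix.mul_assoc,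
      Matrix.mul_nonsing_inv _ hu, one_mul]
  refine ⟨A1 * U, m1, s, U.transpose.mulVec (A1⁻¹.mulVec (m0 - m1)), ?_, hs, ?_, ?_⟩
  · rw [Matrix.det_mul]
    refine mul_ne_zero hA1 fun h => ?_
    have := congrArg Matrix.det hU
    rw [Matrix.det_mul, h, zero_mul, Matrix.det_one] at this
    exact zero_ne_one this
  · rw [h1, ← map_rot U hU _ (meas_aff A1 m1)]
    simp only [Matrix.mulVec_mulVec]
  · have hF : Measurable (fun z => (A1 * U).mulVec ((Matrix.diagonal s).mulVec z +
        U.transpose.mulVec (A1⁻¹.mulVec (m0 - m1))) + m1) :=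
      (meas_aff (A1 * U) m1).comp (meas_aff (Matrix.diagonal s) _)
    rw [h0, ← map_rot W hW _ hF]
    congr 1
    ext1 z
    rw [Matrix.mulVec_add, Matrix.mulVec_mulVec, Matrix.mulVec_mulVec, Matrix.mulVec_mulVec,
      Matrix.mulVec_mulVec, ← hA, Matrix.mul_assoc A1 U, hU, mul_one,
      Matrix.mul_nonsing_inv _ hu, Matrix.one_mulVec]
    abel

lemma exists_match {N : ℕ} (s m s' m' : Fin N → ℝ) (hs : ∀ i, 0 < s i) (hs' : ∀ i, 0 < s' i)
    (h : ∀ t ∈ Set.Ioo (0:ℝ) 1, ∑ i, lK ((s i ^ 2)⁻¹) ((s i ^ 2)⁻¹ * m i ^ 2) t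
      = ∑ i, lK ((s' i ^ 2)⁻¹) ((s' i ^ 2)⁻¹ * m' i ^ 2) t) :
    ∃ V : Matrix (Fin N) (Fin N) ℝ, V * V.transpose = 1 ∧ V.mulVec m = m' ∧
      V * Matrix.diagonal s = Matrix.diagonal s' * V := by
  have hp : ∀ i, 0 < (s i ^ 2)⁻¹ := fun i => by have := hs i; positivity
  have hp' : ∀ i, 0 < (s' i ^ 2)⁻¹ := fun i => by have := hs' i; positivity
  have key := lK_uniq (fun i => (s i ^ 2)⁻¹) (fun i => (s' i ^ 2)⁻¹)
    (fun i => (s i ^ 2)⁻¹ * m i ^ 2) (fun i => (s' i ^ 2)⁻¹ * m' i ^ 2) hp hp' h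
  obtain ⟨σ, hσ⟩ := exists_perm_of_card (fun i => (s i ^ 2)⁻¹) (fun i => (s' i ^ 2)⁻¹)
    (fun x => (key x).1)
  have hss : ∀ i j, (s' i ^ 2)⁻¹ = (s j ^ 2)⁻¹ → s' i = s j := by
    intro i j hij
    exact (pow_left_inj₀ (hs' i).le (hs j).le two_ne_zero).1 (inv_inj.1 hij)
  obtain ⟨Q, hQ, hQm, hQ0⟩ := exists_house (fun i => (s i ^ 2)⁻¹) m (fun i => m' (σ i)) (by
    intro x
    have h2 := (key x).2
    have e1 : ∑ i with (s i ^ 2)⁻¹ = x, (s i ^ 2)⁻¹ * m i ^ 2 =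
        x * ∑ i with (s i ^ 2)⁻¹ = x, m i ^ 2 := by
      rw [Finset.mul_sum]
      exact Finset.sum_congr rfl (fun i hi => by rw [(Finset.mem_filter.1 hi).2])
    have e2 : ∑ i with (s' i ^ 2)⁻¹ = x, (s' i ^ 2)⁻¹ * m' i ^ 2 =
        x * ∑ i with (s' i ^ 2)⁻¹ = x, m' i ^ 2 := by
      rw [Finset.mul_sum]
      exact Finset.sum_congr rfl (fun i hi => by rw [(Finset.mem_filter.1 hi).2])
    have e3 : ∑ i with (s i ^ 2)⁻¹ = x, m' (σ i) ^ 2 = ∑ i with (s' i ^ 2)⁻¹ = x, m' i ^ 2 := by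
      rw [Finset.sum_filter, Finset.sum_filter,
        ← Equiv.sum_comp σ (fun i => if (s' i ^ 2)⁻¹ = x then m' i ^ 2 else 0)]
      apply Finset.sum_congr rfl
      intro i _
      rw [show (s' (σ i) ^ 2)⁻¹ = (s i ^ 2)⁻¹ from hσ i]
    rw [e3]
    by_cases hx : x = 0
    · rw [Finset.sum_filter, Finset.sum_filter]
      apply Finset.sum_congr rfl
      intro i _
      rw [if_neg (hx ▸ (hp i).ne'), if_neg (hx ▸ (hp' i).ne')]
    · exact mul_left_cancel₀ hx (e1 ▸ e2 ▸ h2))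
  refine ⟨Q.submatrix σ.symm id, ?_, ?_, ?_⟩
  · have := Matrix.submatrix_mul_equiv Q Q.transpose σ.symm (Equiv.refl _) σ.symm
    rw [hQ, Matrix.submatrix_one_equiv] at this
    exact this
  · ext i
    have := congrFun hQm (σ.symm i)
    rw [Equiv.apply_symm_apply] at this
    exact this
  · ext i j
    rw [Matrix.mul_diagonal, Matrix.diagonal_mul, Matrix.submatrix_apply, id]
    by_cases hij : (s (σ.symm i) ^ 2)⁻¹ = (s j ^ 2)⁻¹
    · have := hσ (σ.symm i)
      simp only [Equiv.apply_symm_apply] at this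
      rw [hss i j (this.trans hij), mul_comm]
    · rw [hQ0 _ _ hij]; simp

lemma kernel_eq {X Y : Type*} [MeasurableSpace X] [MeasurableSpace Y] (κ : Kernel X Y)
    [IsMarkovKernel κ] (α : Measure X) (β : Measure Y) [IsProbabilityMeasure α]
    [IsProbabilityMeasure β] (h : β ≤ α.bind (fun x => κ x)) : α.bind κ = β := by
  have : IsProbabilityMeasure (α.bind κ) := inferInstance
  exact (Measure.eq_of_le_of_isProbabilityMeasure h).symm

lemma hell_le {N : ℕ} (μ ν : Fin 2 → Measure (Fin N → ℝ)) (T T' : (Fin N → ℝ) → (Fin N → ℝ))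
    (hT : Measurable T) (hT' : Measurable T') (m s m' s' : Fin N → ℝ) (hs : ∀ i, 0 < s i)
    (hs' : ∀ i, 0 < s' i)
    (h1 : μ 1 = (stdGaussianPi N).map T) (h0 : μ 0 = (Gpi m (fun i => (s i ^ 2)⁻¹)).map T)
    (h1' : (ν 1).map T' = (stdGaussianPi N)) (h0' : (ν 0).map T' = (Gpi m' (fun i => (s' i ^ 2)⁻¹)))
    (hν : ∀ i, IsProbabilityMeasure (ν i))
    (κ : Kernel (Fin N → ℝ) (Fin N → ℝ)) (hκ : IsSimulKernel κ μ ν) (t : ℝ)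
    (ht : t ∈ Set.Ioo (0:ℝ) 1) :
    ∑ i, lK ((s i ^ 2)⁻¹) ((s i ^ 2)⁻¹ * m i ^ 2) t
      ≤ ∑ i, lK ((s' i ^ 2)⁻¹) ((s' i ^ 2)⁻¹ * m' i ^ 2) t := by
  obtain ⟨hM, hb⟩ := hκ
  have hp : ∀ i, 0 < (s i ^ 2)⁻¹ := fun i => by have := hs i; positivity
  have hp' : ∀ i, 0 < (s' i ^ 2)⁻¹ := fun i => by have := hs' i; positivity
  have hG : IsProbabilityMeasure (Gpi m (fun i => (s i ^ 2)⁻¹)) := by unfold Gpi; infer_instance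
  have hpush : ∀ (γ : Measure (Fin N → ℝ)) [IsProbabilityMeasure γ] (i : Fin 2), μ i = γ.map T →
      γ.bind ((κ.comap T hT).map T') = (ν i).map T' := by
    intro γ _ i hi
    have hpr : IsProbabilityMeasure (μ i) := by
      rw [hi]; exact Measure.isProbabilityMeasure_map hT.aemeasurable
    have := hν i
    rw [← kernel_eq κ (μ i) (ν i) (hb i), hi]
    ext S hS
    rw [Measure.bind_apply hS (Kernel.measurable _).aemeasurable, Measure.map_apply hT' hS,
      Measure.bind_apply (hT' hS) κ.measurable.aemeasurable,
      lintegral_map (κ.measurable_coe (hT' hS)) hT]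
    apply lintegral_congr
    intro x
    rw [Kernel.map_apply' _ hT' _ hS, Kernel.comap_apply]
  have hk : IsMarkovKernel ((κ.comap T hT).map T') := Kernel.IsMarkovKernel.map _ hT'
  have := dpi ((κ.comap T hT).map T') (stdGaussianPi N) (stdGaussianPi N)
    (Fd m (fun i => (s i ^ 2)⁻¹)) (Fd m' (fun i => (s' i ^ 2)⁻¹)) (Fd_meas _ _) (Fd_meas _ _)
    (Fd_pos _ _) (Fd_pos _ _) ((hpush _ 1 h1).trans h1')
    (by
      rw [← Gpi_density _ _ hp, ← Gpi_density _ _ hp']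
      exact (hpush _ 0 h0).trans h0') t ht
  rw [hell_pi _ _ hp _ ht, hell_pi _ _ hp' _ ht] at this
  exact Real.exp_le_exp.1 ((ENNReal.ofReal_le_ofReal_iff (Real.exp_nonneg _)).1 this)

lemma aff_inv {N : ℕ} (A : Matrix (Fin N) (Fin N) ℝ) (hA : A.det ≠ 0) (b x : Fin N → ℝ) :
    A⁻¹.mulVec (A.mulVec x + b) + - A⁻¹.mulVec b = x := by
  rw [Matrix.mulVec_add, Matrix.mulVec_mulVec, Matrix.nonsing_inv_mul _ (isUnit_iff_ne_zero.2 hA),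
    Matrix.one_mulVec]
  abel

lemma aff_map_inv {N : ℕ} (A : Matrix (Fin N) (Fin N) ℝ) (hA : A.det ≠ 0) (b : Fin N → ℝ)
    (γ : Measure (Fin N → ℝ)) :
    (γ.map (fun x => A.mulVec x + b)).map (fun x => A⁻¹.mulVec x + - A⁻¹.mulVec b) = γ := by
  rw [Measure.map_map (meas_aff _ _) (meas_aff _ _)]
  conv_rhs => rw [← Measure.map_id (μ := γ)]
  congr 1
  ext1 x
  exact aff_inv A hA b x

lemma simul_of_map {N : ℕ} (μ ν : Fin 2 → Measure (Fin N → ℝ)) (T : (Fin N → ℝ) → (Fin N → ℝ))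
    (hT : Measurable T) (h : ∀ i, (μ i).map T = ν i) :
    IsSimulKernel (Kernel.deterministic T hT) μ ν := by
  refine ⟨inferInstance, fun j => ?_⟩
  rw [← h j]
  exact (Measure.deterministic_comp_eq_map hT).symm.le

theorem stmt15 {N : ℕ} (μ ν : Fin 2 → Measure (Fin N → ℝ))
    (hμ : ∀ i, IsNondegGaussian (μ i)) (hν : ∀ i, IsNondegGaussian (ν i)) :
    ((∃ κ : Kernel (Fin N → ℝ) (Fin N → ℝ), IsSimulKernel κ μ ν) ∧
      (∃ κ : Kernel (Fin N → ℝ) (Fin N → ℝ), IsSimulKernel κ ν μ)) ↔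
    ∃ (A : Matrix (Fin N) (Fin N) ℝ) (b : Fin N → ℝ), A.det ≠ 0 ∧
      ∀ i, (μ i).map (fun x => A.mulVec x + b) = ν i := by
  constructor
  · rintro ⟨⟨κ, hκ⟩, ⟨κ', hκ'⟩⟩
    have pr : ∀ γ : Measure (Fin N → ℝ), IsNondegGaussian γ → IsProbabilityMeasure γ := by
      rintro γ ⟨A, m, -, rfl⟩
      exact Measure.isProbabilityMeasure_map (meas_aff A m).aemeasurable
    obtain ⟨B, b, s, m, hB, hs, h1, h0⟩ := normal_form μ hμ
    obtain ⟨B', b', s', m', hB', hs', h1', h0'⟩ := normal_form ν hν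
    have g0 : μ 0 = (Gpi m (fun i => (s i ^ 2)⁻¹)).map (fun z => B.mulVec z + b) := by
      rw [h0, ← map_diag, Measure.map_map (meas_aff _ _) (meas_aff _ _)]
      rfl
    have g0' : ν 0 = (Gpi m' (fun i => (s' i ^ 2)⁻¹)).map (fun z => B'.mulVec z + b') := by
      rw [h0', ← map_diag, Measure.map_map (meas_aff _ _) (meas_aff _ _)]
      rfl
    obtain ⟨V, hV, hVm, hVs⟩ := exists_match s m s' m' hs hs' (fun t ht => le_antisymm
      (hell_le μ ν _ _ (meas_aff B b) (meas_aff B'⁻¹ (- B'⁻¹.mulVec b')) m s m' s' hs hs' h1 g0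
        (by rw [h1', aff_map_inv _ hB']) (by rw [g0', aff_map_inv _ hB'])
        (fun i => pr _ (hν i)) κ hκ t ht)
      (hell_le ν μ _ _ (meas_aff B' b') (meas_aff B⁻¹ (- B⁻¹.mulVec b)) m' s' m s hs' hs h1' g0'
        (by rw [h1, aff_map_inv _ hB]) (by rw [g0, aff_map_inv _ hB])
        (fun i => pr _ (hμ i)) κ' hκ' t ht))
    have hu : IsUnit B.det := isUnit_iff_ne_zero.2 hB
    have hVd : V.det ≠ 0 := by
      intro h
      have := congrArg Matrix.det hV
      rw [Matrix.det_mul, h, zero_mul, Matrix.det_one] at this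
      exact zero_ne_one this
    have hcomp : ∀ y, (B' * V * B⁻¹).mulVec (B.mulVec y + b) + (b' - (B' * V * B⁻¹).mulVec b)
        = B'.mulVec (V.mulVec y) + b' := by
      intro y
      rw [Matrix.mulVec_add, Matrix.mulVec_mulVec, Matrix.mul_assoc, Matrix.nonsing_inv_mul _ hu,
        mul_one, Matrix.mulVec_mulVec]
      abel
    refine ⟨B' * V * B⁻¹, b' - (B' * V * B⁻¹).mulVec b, ?_, ?_⟩
    · rw [Matrix.det_mul, Matrix.det_mul]
      exact mul_ne_zero (mul_ne_zero hB' hVd) (Matrix.isUnit_nonsing_inv_det B hu).ne_zero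
    · intro i
      fin_cases i
      · change (μ 0).map _ = ν 0
        have mm : Measurable (fun z => B.mulVec ((Matrix.diagonal s).mulVec z + m) + b) :=
          (meas_aff B b).comp (meas_aff (Matrix.diagonal s) m)
        have mm' : Measurable (fun z => B'.mulVec ((Matrix.diagonal s').mulVec z + m') + b') :=
          (meas_aff B' b').comp (meas_aff (Matrix.diagonal s') m')
        rw [h0, h0', Measure.map_map (meas_aff _ _) mm, ← map_rot V hV _ mm']
        congr 1
        ext1 z
        simp only [Function.comp]
        rw [hcomp, Matrix.mulVec_add, Matrix.mulVec_mulVec, hVs, hVm, Matrix.mulVec_mulVec]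
      · change (μ 1).map _ = ν 1
        rw [h1, h1', Measure.map_map (meas_aff _ _) (meas_aff B b),
          ← map_rot V hV _ (meas_aff B' b')]
        congr 1
        ext1 z
        exact hcomp z
  · rintro ⟨A, b, hA, h⟩
    refine ⟨⟨_, simul_of_map μ ν _ (meas_aff A b) h⟩,
      ⟨_, simul_of_map ν μ _ (meas_aff A⁻¹ (- A⁻¹.mulVec b)) fun i => ?_⟩⟩
    rw [← h i, aff_map_inv A hA]

end
end

section
/- Let μ = (μ_1,…,μ_d) be a jointly atomless d-tuple of Borel probability measures on a Polish space X, let B ⊆ X be a Borel set, and let m ≤ d be such that μ_j(B) > 0 for every j ∈ {1,…,m}. Then the m-tuple of normalized restrictions ( μ_1|_B / μ_1(B), …, μ_m|_B / μ_m(B) ), where μ_j|_B(A) := μ_j(A ∩ B), is a jointly atomless m-tuple of Borel probability measures. -/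
open MeasureTheory ProbabilityTheory ENNReal

noncomputable section

theorem aux_cont (ν : Measure ℝ) [IsProbabilityMeasure ν] (h : ∀ r, ν {r} = 0) :
    Continuous (cdf ν) := by
  rw [continuous_iff_continuousAt]
  intro x
  rw [(monotone_cdf ν).continuousAt_iff_leftLim_eq_rightLim, (cdf ν).rightLim_eq]
  have h1 := (cdf ν).measure_singleton x
  rw [measure_cdf, h x] at h1
  have h2 := ENNReal.ofReal_eq_zero.1 h1.symm
  have h3 := (monotone_cdf ν).leftLim_le (le_refl x)
  linarith

theorem aux_unif (ν : Measure ℝ) [IsProbabilityMeasure ν] (h : ∀ r, ν {r} = 0) :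
    ν.map (cdf ν) = volume.restrict (Set.Icc (0:ℝ) 1) := by
  have hc := aux_cont ν h
  have : IsProbabilityMeasure (ν.map (cdf ν)) :=
    Measure.isProbabilityMeasure_map hc.measurable.aemeasurable
  refine Measure.ext_of_Iic _ _ (fun t => ?_)
  rw [Measure.map_apply hc.measurable measurableSet_Iic,
    Measure.restrict_apply measurableSet_Iic]
  rcases lt_or_ge t 0 with ht | ht
  · have e1 : (cdf ν) ⁻¹' Set.Iic t = ∅ := by
      ext x
      have := cdf_nonneg ν x
      simp only [Set.mem_preimage, Set.mem_Iic, Set.mem_empty_iff_false, iff_false]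
      linarith
    have e2 : Set.Iic t ∩ Set.Icc (0:ℝ) 1 = ∅ := by
      ext x
      simp only [Set.mem_inter_iff, Set.mem_Iic, Set.mem_Icc, Set.mem_empty_iff_false, iff_false]
      rintro ⟨a, b, c⟩
      linarith
    rw [e1, e2]; simp
  rcases le_or_gt 1 t with ht1 | ht1
  · have e1 : (cdf ν) ⁻¹' Set.Iic t = Set.univ := by
      ext x
      have := cdf_le_one ν x
      simp only [Set.mem_preimage, Set.mem_Iic, Set.mem_univ, iff_true]
      linarith
    have e2 : Set.Iic t ∩ Set.Icc (0:ℝ) 1 = Set.Icc 0 1 :=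
      Set.inter_eq_right.2 fun x hx => hx.2.trans ht1
    rw [e1, e2]; simp
  have e2 : Set.Iic t ∩ Set.Icc (0:ℝ) 1 = Set.Icc 0 t := by
    ext x
    simp only [Set.mem_inter_iff, Set.mem_Iic, Set.mem_Icc]
    constructor
    · rintro ⟨a, b, c⟩; exact ⟨b, a⟩
    · rintro ⟨a, b⟩; exact ⟨b, a, by linarith⟩
  rw [e2, Real.volume_Icc, sub_zero]
  rcases Set.eq_empty_or_nonempty ((cdf ν) ⁻¹' Set.Iic t) with he | hne
  · have h0 : t ≤ 0 := by
      refine ge_of_tendsto' (tendsto_cdf_atBot ν) (fun x => ?_)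
      by_contra hx
      have : x ∈ (cdf ν) ⁻¹' Set.Iic t := (not_le.1 hx).le
      rw [he] at this
      exact this
    rw [he, ENNReal.ofReal_of_nonpos h0]; simp
  · obtain ⟨b, hb⟩ := ((tendsto_cdf_atTop ν).eventually (lt_mem_nhds ht1)).exists
    have hbdd : BddAbove ((cdf ν) ⁻¹' Set.Iic t) := by
      refine ⟨b, fun x hx => ?_⟩
      by_contra hxb
      have h1 := monotone_cdf ν (not_le.1 hxb).le
      have h2 : cdf ν x ≤ t := hx
      linarith
    have hmem := (isClosed_Iic.preimage hc).csSup_mem hne hbdd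
    set x₀ := sSup ((cdf ν) ⁻¹' Set.Iic t) with hx₀
    have hle : cdf ν x₀ ≤ t := hmem
    have e1 : (cdf ν) ⁻¹' Set.Iic t = Set.Iic x₀ := by
      ext x
      constructor
      · intro hx; exact le_csSup hbdd hx
      · intro hx; exact (monotone_cdf ν hx).trans hle
    have hge : t ≤ cdf ν x₀ := by
      have ht : Filter.Tendsto (cdf ν) (nhdsWithin x₀ (Set.Ioi x₀)) (nhds (cdf ν x₀)) :=
        hc.continuousAt.tendsto.mono_left nhdsWithin_le_nhds
      refine ge_of_tendsto ht ?_
      filter_upwards [self_mem_nhdsWithin] with x hx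
      by_contra hxt
      have : x ∈ (cdf ν) ⁻¹' Set.Iic t := (not_le.1 hxt).le
      rw [e1] at this
      exact absurd (Set.mem_Iic.1 this) (not_le.2 hx)
    rw [e1, ← ofReal_cdf, le_antisymm hle hge]

theorem aux_main {X Z : Type*} [MeasurableSpace X] [MeasurableSpace Z]
    (lam lam' : Measure X) [IsProbabilityMeasure lam] [IsProbabilityMeasure lam']
    (hac : lam' ≪ lam) (g : X → Z) (ξ : X → ℝ) (hg : Measurable g) (hξ : Measurable ξ)
    (hat : ∀ r : ℝ, lam (ξ ⁻¹' {r}) = 0) (hind : IndepFun ξ g lam) :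
    ∃ η : X → ℝ, Measurable η ∧ (∀ r : ℝ, lam' (η ⁻¹' {r}) = 0) ∧ IndepFun η g lam' := by
  set κ := condDistrib ξ g lam' with hκ
  have hP : IsProbabilityMeasure (lam.map ξ) := Measure.isProbabilityMeasure_map hξ.aemeasurable
  have hP2 : IsProbabilityMeasure (lam.map g) := Measure.isProbabilityMeasure_map hg.aemeasurable
  have hP3 : IsProbabilityMeasure (lam'.map g) := Measure.isProbabilityMeasure_map hg.aemeasurable
  have hρ : (lam'.map g) ⊗ₘ κ = lam'.map (fun x => (g x, ξ x)) :=
    compProd_map_condDistrib hξ.aemeasurable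
  have hprod : lam.map (fun x => (g x, ξ x)) = (lam.map g) ⊗ₘ (Kernel.const Z (lam.map ξ)) := by
    rw [Measure.compProd_const]
    exact (indepFun_iff_map_prod_eq_prod_map_map hg.aemeasurable hξ.aemeasurable).1 hind.symm
  have hacρ : (lam'.map g) ⊗ₘ κ ≪ (lam.map g) ⊗ₘ (Kernel.const Z (lam.map ξ)) := by
    rw [hρ, ← hprod]
    exact hac.map (hg.prodMk hξ)
  have hκac := hacρ.kernel_of_compProd
  have hunif : ∀ᵐ z ∂(lam'.map g), (κ z).map (cdf (κ z)) = volume.restrict (Set.Icc (0:ℝ) 1) := by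
    filter_upwards [hκac] with z hz
    refine aux_unif _ (fun r => hz ?_)
    rw [Kernel.const_apply, Measure.map_apply hξ (measurableSet_singleton r), hat r]
  have hF : Measurable (fun p : Z × ℝ => cdf (κ p.1) p.2) := by
    have h1 : Measurable (fun p : Z × ℝ => κ p.1 (Set.Iic p.2)) := by
      have hs : MeasurableSet {q : (Z × ℝ) × ℝ | q.2 ≤ q.1.2} :=
        measurableSet_le measurable_snd (measurable_snd.comp measurable_fst)
      exact Kernel.measurable_kernel_prodMk_left (κ := Kernel.prodMkRight ℝ κ) hs
    have h2 : (fun p : Z × ℝ => cdf (κ p.1) p.2) =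
        fun p : Z × ℝ => (κ p.1 (Set.Iic p.2)).toReal := by
      ext p
      rw [cdf_eq_real]; rfl
    rw [h2]
    exact h1.ennreal_toReal
  have hη : Measurable (fun x => cdf (κ (g x)) (ξ x)) := hF.comp (hg.prodMk hξ)
  have hU : IsProbabilityMeasure (volume.restrict (Set.Icc (0:ℝ) 1)) := ⟨by simp⟩
  have hjoint : lam'.map (fun x => (g x, cdf (κ (g x)) (ξ x))) =
      (lam'.map g).prod (volume.restrict (Set.Icc (0:ℝ) 1)) := by
    have hm2 : Measurable (fun p : Z × ℝ => (p.1, cdf (κ p.1) p.2)) := measurable_fst.prodMk hF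
    have e : lam'.map (fun x => (g x, cdf (κ (g x)) (ξ x))) =
        ((lam'.map g) ⊗ₘ κ).map (fun p : Z × ℝ => (p.1, cdf (κ p.1) p.2)) := by
      rw [hρ, Measure.map_map hm2 (hg.prodMk hξ)]; rfl
    rw [e]
    ext S hS
    rw [Measure.map_apply hm2 hS, Measure.compProd_apply (hm2 hS), Measure.prod_apply hS]
    refine lintegral_congr_ae ?_
    filter_upwards [hunif] with z hz
    rw [← hz, Measure.map_apply (cdf (κ z)).mono.measurable (measurable_prodMk_left hS)]
    rfl
  have hlaw : lam'.map (fun x => cdf (κ (g x)) (ξ x)) = volume.restrict (Set.Icc (0:ℝ) 1) := by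
    have := congrArg Measure.snd hjoint
    rwa [Measure.snd_prod, Measure.snd_map_prodMk hg] at this
  refine ⟨_, hη, fun r => ?_, ?_⟩
  · rw [← Measure.map_apply hη (measurableSet_singleton r), hlaw]
    simp
  · refine IndepFun.symm ?_
    rw [indepFun_iff_map_prod_eq_prod_map_map hg.aemeasurable hη.aemeasurable, hjoint, hlaw]

theorem stmt16 {X : Type*}
    [MeasurableSpace X] [TopologicalSpace X] [PolishSpace X] [BorelSpace X]
    {d m : ℕ} (hm : m ≤ d)
    (μ : Fin d → Measure X) (hμ : ∀ j, IsProbabilityMeasure (μ j))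
    (hja : JointlyAtomless μ)
    (B : Set X) (hB : MeasurableSet B)
    (hpos : ∀ j : Fin m, 0 < μ (Fin.castLE hm j) B) :
    JointlyAtomless (fun j : Fin m =>
      (μ (Fin.castLE hm j) B)⁻¹ • (μ (Fin.castLE hm j)).restrict B) := by
  obtain ⟨lam, g, ξ, hlam, hg, hξ, hd, hat, hind⟩ := hja
  rcases Nat.eq_zero_or_pos m with hm0 | hm0
  · subst hm0
    refine ⟨lam, fun _ => 0, ξ, hlam, measurable_const, hξ, fun j => j.elim0, hat, ?_⟩
    exact indepFun_const_right _ _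
  have hac : ∀ j, μ j ≪ lam := fun j => by
    rw [hd j]; exact withDensity_absolutelyContinuous _ _
  have hB0 : lam B ≠ 0 := fun h0 => (hpos ⟨0, hm0⟩).ne' (hac _ h0)
  have hBt : lam B ≠ ∞ := measure_ne_top _ _
  have hlam' : IsProbabilityMeasure ((lam B)⁻¹ • lam.restrict B) :=
    ⟨by simp [ENNReal.inv_mul_cancel hB0 hBt]⟩
  have hac' : (lam B)⁻¹ • lam.restrict B ≪ lam :=
    Measure.absolutelyContinuous_of_le_smul (c := (lam B)⁻¹) (by gcongr; exact Measure.restrict_le_self)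
  obtain ⟨η, hη, hηat, hηind⟩ := aux_main lam _ hac' g ξ hg hξ hat hind
  have hφ : Measurable (fun (z : Fin d → ℝ) (j : Fin m) =>
      (lam B * (μ (Fin.castLE hm j) B)⁻¹).toReal * z (Fin.castLE hm j)) := by
    fun_prop
  refine ⟨_, fun x j => (lam B * (μ (Fin.castLE hm j) B)⁻¹).toReal * g x (Fin.castLE hm j), η,
    hlam', hφ.comp hg, hη, fun j => ?_, hηat, hηind.comp measurable_id hφ⟩
  have hc : lam B * (μ (Fin.castLE hm j) B)⁻¹ ≠ ∞ :=
    ENNReal.mul_ne_top hBt (ENNReal.inv_ne_top.2 (hpos j).ne')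
  have hgm : Measurable fun x => ENNReal.ofReal (g x (Fin.castLE hm j)) :=
    ((measurable_pi_apply _).comp hg).ennreal_ofReal
  have e : (fun x => ENNReal.ofReal ((lam B * (μ (Fin.castLE hm j) B)⁻¹).toReal *
      g x (Fin.castLE hm j))) = (lam B * (μ (Fin.castLE hm j) B)⁻¹) •
      fun x => ENNReal.ofReal (g x (Fin.castLE hm j)) := by
    ext x
    rw [ENNReal.ofReal_mul ENNReal.toReal_nonneg, ENNReal.ofReal_toReal hc]; rfl
  rw [e, withDensity_smul_measure, withDensity_smul _ hgm, ← restrict_withDensity hB, ← hd,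
    smul_smul, ← mul_assoc, ENNReal.inv_mul_cancel hB0 hBt, one_mul]

end
end

section
/- Let μ and ν be d-tuples of Borel probability measures on Polish spaces X and Y with μ̄∘(μ')⁻¹ = ν̄∘(ν')⁻¹ =: P as Borel measures on ℝ^d, and let (μ_z) and (ν_z) be disintegrations of (μ̄,μ') and (ν̄,ν'). If κ is a Markov kernel from X to Y such that for P-almost every z ∈ ℝ^d the Borel measure B ↦ ∫_X κ(x,B) dμ_z(x) on Y equals ν_z, then κ ∈ K(μ,ν), i.e., ∫_X κ(x,B) dμ_j(x) = ν_j(B) for every j ∈ {1,…,d} and every Borel B ⊆ Y. -/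
open MeasureTheory ProbabilityTheory ENNReal

noncomputable section

theorem disint_aux {X : Type*} [MeasurableSpace X] {d : ℕ}
    (μ : Fin d → Measure X) (m : Measure X) (g : X → Fin d → ℝ) (hg : IsDensityVec μ m g)
    (P : Measure (Fin d → ℝ)) (K : Kernel (Fin d → ℝ) X) (hK : IsDisintegration P g m K)
    (F : X → ℝ≥0∞) (hF : Measurable F) (j : Fin d) :
    ∫⁻ x, F x ∂(μ j) = ∫⁻ z, ENNReal.ofReal (z j) * ∫⁻ x, F x ∂(K z) ∂P := by
  obtain ⟨hgm, hd⟩ := hg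
  obtain ⟨hM, hc, hm⟩ := hK
  have hw : Measurable (fun x => ENNReal.ofReal (g x j)) := by fun_prop
  rw [hd j, lintegral_withDensity_eq_lintegral_mul _ hw hF, hm,
    Measure.lintegral_bind K.measurable.aemeasurable (hw.mul hF).aemeasurable]
  refine lintegral_congr_ae ?_
  filter_upwards [hc] with z hz
  have hae : ∀ᵐ x ∂(K z), x ∈ g ⁻¹' {z} :=
    (mem_ae_iff_prob_eq_one (hgm (measurableSet_singleton z))).2 hz
  rw [← lintegral_const_mul _ hF]
  refine lintegral_congr_ae ?_
  filter_upwards [hae] with x hx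
  have hx' : g x = z := hx
  simp [hx']

theorem stmt19 {X Y : Type*}
    [MeasurableSpace X] [TopologicalSpace X] [PolishSpace X] [BorelSpace X]
    [MeasurableSpace Y] [TopologicalSpace Y] [PolishSpace Y] [BorelSpace Y]
    {d : ℕ} (hd : 0 < d)
    (μ : Fin d → Measure X) (ν : Fin d → Measure Y)
    (hμ : ∀ j, IsProbabilityMeasure (μ j)) (hν : ∀ j, IsProbabilityMeasure (ν j))
    (μ' : X → Fin d → ℝ) (ν' : Y → Fin d → ℝ)
    (hμ' : IsDensityVec μ (avg μ) μ') (hν' : IsDensityVec ν (avg ν) ν')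
    (P : Measure (Fin d → ℝ))
    (hPμ : (avg μ).map μ' = P) (hPν : (avg ν).map ν' = P)
    (μz : Kernel (Fin d → ℝ) X) (νz : Kernel (Fin d → ℝ) Y)
    (hμz : IsDisintegration P μ' (avg μ) μz) (hνz : IsDisintegration P ν' (avg ν) νz)
    (κ : Kernel X Y) (hκ : IsMarkovKernel κ)
    (h : ∀ᵐ z ∂P, (μz z).bind (fun x => κ x) = νz z) :
    ∀ j, (μ j).bind (fun x => κ x) = ν j := by
  intro j
  ext B hB
  rw [Measure.bind_apply hB κ.measurable.aemeasurable,
    disint_aux μ _ μ' hμ' P μz hμz _ (κ.measurable_coe hB) j,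
    ← lintegral_indicator_one hB,
    disint_aux ν _ ν' hν' P νz hνz _ (measurable_one.indicator hB) j]
  refine lintegral_congr_ae ?_
  filter_upwards [h] with z hz
  rw [lintegral_indicator_one hB, ← hz, Measure.bind_apply hB κ.measurable.aemeasurable]

end
end
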